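/- arXiv:2603.07094 — 2 statements merged into one kernel-verified Lean document; each statement's English description precedes it below -/
import Mathlib

section
/- Fix n ∈ ℕ and, for each non-target state s, let the rank ℓ(s) be the smallest k ∈ {1, …, n} such that v_k(s) = v_n(s). Then for every non-target state s there exists a collective selector ξ̄^s at s such that, for every opponent action b available at s, the expected value of the valuation v_{ℓ(s)−1} at the successor state (when the team's joint action is drawn from ξ̄^s, the opponent plays b, and the successor is drawn from δ) is at least v_{ℓ(s)}(s). -/
/-!
Common framework: team concurrent stochastic reachability games.
-/

noncomputable section

/-- A concurrent game structure: finitely many players, finitely many states,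
finitely many actions per player, available actions, and a probabilistic
transition function. -/
structure GameStructure where
  Player : Type
  [playerFin : Fintype Player]
  [playerDec : DecidableEq Player]
  State : Type
  [stateFin : Fintype State]
  [stateDec : DecidableEq State]
  Act : Player → Type
  [actFin : ∀ p, Fintype (Act p)]
  [actDec : ∀ p, DecidableEq (Act p)]
  Av : (p : Player) → State → Finset (Act p)
  av_nonempty : ∀ p s, (Av p s).Nonempty
  trans : State → ((p : Player) → Act p) → State → ℝ
  trans_nonneg : ∀ s a t, 0 ≤ trans s a t
  trans_sum : ∀ s a, ∑ t, trans s a t = 1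

attribute [instance] GameStructure.playerFin GameStructure.playerDec
  GameStructure.stateFin GameStructure.stateDec GameStructure.actFin GameStructure.actDec

/-- A (behavioural) strategy of player `p`: a distribution over available
actions, for every history `h` (the list of previously visited states)
and current state `s`. -/
structure Strategy (G : GameStructure) (p : G.Player) where
  toFun : List G.State → G.State → G.Act p → ℝ
  nonneg : ∀ h s a, 0 ≤ toFun h s a
  support_av : ∀ h s a, a ∉ G.Av p s → toFun h s a = 0
  sum_one : ∀ h s, ∑ a, toFun h s a = 1

/-- A strategy is memoryless if it only depends on the current state. -/
def Strategy.Memoryless {G : GameStructure} {p : G.Player} (σ : Strategy G p) : Prop :=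
  ∀ h h' s, σ.toFun h s = σ.toFun h' s

/-- A strategy is deterministic if it always plays a single action with probability 1. -/
def Strategy.Deterministic {G : GameStructure} {p : G.Player} (σ : Strategy G p) : Prop :=
  ∀ h s, ∃ a, σ.toFun h s a = 1

/-- A selector of player `p` at state `s`: a distribution over the available actions. -/
structure Selector (G : GameStructure) (p : G.Player) (s : G.State) where
  toFun : G.Act p → ℝ
  nonneg : ∀ a, 0 ≤ toFun a
  support_av : ∀ a, a ∉ G.Av p s → toFun a = 0
  sum_one : ∑ a, toFun a = 1

/-- A game: a game structure together with a team, an absorbing target set,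
and an initial state. -/
structure Game extends GameStructure where
  team : Finset Player
  target : Finset State
  init : State
  absorbing : ∀ t ∈ target, ∀ a, trans t a t = 1

namespace Game

variable (Gm : Game)

abbrev TeamPlayer := {p : Gm.Player // p ∈ Gm.team}
abbrev OppPlayer := {p : Gm.Player // p ∉ Gm.team}

/-- A collective strategy: one strategy for each team player. -/
abbrev TeamStrategy := (p : Gm.TeamPlayer) → Strategy Gm.toGameStructure p.1
/-- An opponent strategy: one strategy for each player outside the team. -/
abbrev OppStrategy := (p : Gm.OppPlayer) → Strategy Gm.toGameStructure p.1

abbrev TeamAct := (p : Gm.TeamPlayer) → Gm.Act p.1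
abbrev OppAct := (p : Gm.OppPlayer) → Gm.Act p.1

/-- A collective selector at state `s`. -/
abbrev TeamSelector (s : Gm.State) := (p : Gm.TeamPlayer) → Selector Gm.toGameStructure p.1 s

def MemorylessTeam (σ : Gm.TeamStrategy) : Prop := ∀ p, (σ p).Memoryless
def DeterministicTeam (σ : Gm.TeamStrategy) : Prop := ∀ p, (σ p).Deterministic
def MemorylessOpp (τ : Gm.OppStrategy) : Prop := ∀ p, (τ p).Memoryless

/-- Combine a collective strategy and an opponent strategy into a full profile. -/
def combine (σ : Gm.TeamStrategy) (τ : Gm.OppStrategy) (p : Gm.Player) :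
    Strategy Gm.toGameStructure p :=
  if h : p ∈ Gm.team then σ ⟨p, h⟩ else τ ⟨p, h⟩

/-- Combine a joint team action and a joint opponent action into a full action profile. -/
def combineAct (a : Gm.TeamAct) (b : Gm.OppAct) (p : Gm.Player) : Gm.Act p :=
  if h : p ∈ Gm.team then a ⟨p, h⟩ else b ⟨p, h⟩

/-- A joint opponent action is available at `s`. -/
def OppAvailable (s : Gm.State) (b : Gm.OppAct) : Prop := ∀ p, b p ∈ Gm.Av p.1 s

/-- One-step transition probability, under a full strategy profile, from state `s`
with history `h`, to state `t` (players randomise independently). -/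
def stepProb (π : (p : Gm.Player) → Strategy Gm.toGameStructure p)
    (h : List Gm.State) (s t : Gm.State) : ℝ :=
  ∑ a : (p : Gm.Player) → Gm.Act p, (∏ p, (π p).toFun h s (a p)) * Gm.trans s a t

/-- Probability of visiting the target within `n` steps, starting at state `s`
with history `h`. -/
def reachWithin (π : (p : Gm.Player) → Strategy Gm.toGameStructure p) :
    ℕ → List Gm.State → Gm.State → ℝ
  | 0, _, s => if s ∈ Gm.target then 1 else 0
  | n + 1, h, s =>
      if s ∈ Gm.target then 1
      else ∑ t, Gm.stepProb π h s t * reachWithin π n (h ++ [s]) t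

/-- Probability of eventually reaching the target set, starting from state `s`. -/
def reachProbFrom (π : (p : Gm.Player) → Strategy Gm.toGameStructure p) (s : Gm.State) : ℝ :=
  ⨆ n : ℕ, Gm.reachWithin π n [] s

/-- Probability of eventually reaching the target set from the initial state. -/
def reachProb (π : (p : Gm.Player) → Strategy Gm.toGameStructure p) : ℝ :=
  Gm.reachProbFrom π Gm.init

/-- Probability of visiting the target set for the first time exactly at step `k`. -/
def firstHit (π : (p : Gm.Player) → Strategy Gm.toGameStructure p) :
    ℕ → List Gm.State → Gm.State → ℝ
  | 0, _, s => if s ∈ Gm.target then 1 else 0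
  | k + 1, h, s =>
      if s ∈ Gm.target then 0
      else ∑ t, Gm.stepProb π h s t * firstHit π k (h ++ [s]) t

/-- Expected `lam`-discounted payoff from the initial state: the play pays `lam ^ k`
if it first visits the target at step `k`, and `0` if it never visits the target. -/
def discounted (π : (p : Gm.Player) → Strategy Gm.toGameStructure p) (lam : ℝ) : ℝ :=
  ∑' k : ℕ, lam ^ k * Gm.firstHit π k [] Gm.init

/-- A play (an infinite sequence of states from the initial state) is compatible with
a strategy profile if each of its transitions occurs with positive probability. -/
def CompatiblePlay (π : (p : Gm.Player) → Strategy Gm.toGameStructure p)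
    (play : ℕ → Gm.State) : Prop :=
  play 0 = Gm.init ∧
  ∀ n, 0 < Gm.stepProb π (List.ofFn fun i : Fin n => play i.1) (play n) (play (n + 1))

/-- Expected value of the valuation `v` at the successor of `s`, when the team plays
according to the collective selector `ξ` and the opponent plays the joint action `b`. -/
def preTeamAct (v : Gm.State → ℝ) (s : Gm.State) (ξ : Gm.TeamSelector s) (b : Gm.OppAct) : ℝ :=
  ∑ a : Gm.TeamAct, (∏ p, (ξ p).toFun (a p)) * ∑ t, Gm.trans s (Gm.combineAct a b) t * v t

/-- An opponent selector at state `s`: a distribution over available joint opponent actions. -/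
structure OppSelector (s : Gm.State) where
  toFun : Gm.OppAct → ℝ
  nonneg : ∀ b, 0 ≤ toFun b
  support_av : ∀ b, ¬ Gm.OppAvailable s b → toFun b = 0
  sum_one : ∑ b, toFun b = 1

/-- Expected value of `v` at the successor of `s` under a collective selector `ξ`
and an opponent selector `ζ`. -/
def preSel (v : Gm.State → ℝ) (s : Gm.State) (ξ : Gm.TeamSelector s) (ζ : Gm.OppSelector s) : ℝ :=
  ∑ b, ζ.toFun b * Gm.preTeamAct v s ξ b

/-- The predecessor operator: best one-step value the team can guarantee. -/
def pre (v : Gm.State → ℝ) (s : Gm.State) : ℝ :=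
  ⨆ ξ : Gm.TeamSelector s, ⨅ ζ : Gm.OppSelector s, Gm.preSel v s ξ ζ

/-- The value iteration sequence: `vIter 0` is the indicator of the target set
and `vIter (n+1) = pre (vIter n)`. -/
def vIter : ℕ → Gm.State → ℝ
  | 0 => fun s => if s ∈ Gm.target then 1 else 0
  | n + 1 => Gm.pre (vIter n)

/-- The max-min value of the game started at `s`. -/
def maxminFrom (s : Gm.State) : ℝ :=
  ⨆ σ : Gm.TeamStrategy, ⨅ τ : Gm.OppStrategy, Gm.reachProbFrom (Gm.combine σ τ) s

/-- The set of states from which the team can win almost surely. -/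
def winSet : Set Gm.State :=
  {s | ∃ σ : Gm.TeamStrategy, ∀ τ : Gm.OppStrategy, Gm.reachProbFrom (Gm.combine σ τ) s = 1}

/-- Distribution of the successor of `s` when the team plays the collective
selector `ξ` and the opponent plays the joint action `b`. -/
def succProbSel (s : Gm.State) (ξ : Gm.TeamSelector s) (b : Gm.OppAct) (t : Gm.State) : ℝ :=
  ∑ a : Gm.TeamAct, (∏ p, (ξ p).toFun (a p)) * Gm.trans s (Gm.combineAct a b) t

/-- Distribution of the successor of `s` (with history `h`) when the team plays the
collective strategy `σ` and the opponent plays the joint action `b`. -/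
def succProbTeam (σ : Gm.TeamStrategy) (h : List Gm.State) (s : Gm.State)
    (b : Gm.OppAct) (t : Gm.State) : ℝ :=
  ∑ a : Gm.TeamAct, (∏ p, (σ p).toFun h s (a p)) * Gm.trans s (Gm.combineAct a b) t

/-- The layered decomposition of the almost-sure winning set. -/
def wSeq : ℕ → Set Gm.State
  | 0 => ↑Gm.target
  | k + 1 =>
      wSeq k ∪
      {s ∈ Gm.winSet | ∃ ξ : Gm.TeamSelector s, ∀ b : Gm.OppAct, Gm.OppAvailable s b →
        (0 < ∑ t, (wSeq k).indicator (Gm.succProbSel s ξ b) t) ∧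
        (∑ t, Gm.winSet.indicator (Gm.succProbSel s ξ b) t = 1)}

end Game

namespace Selector

variable {G : GameStructure} {p : G.Player} {s : G.State}

/-- The selector playing a fixed available action. -/
def pure (a : G.Act p) (ha : a ∈ G.Av p s) : Selector G p s where
  toFun := Pi.single a 1
  nonneg c := by
    by_cases h : c = a
    · subst h; simp
    · simp [h]
  support_av c hc := Pi.single_eq_of_ne (by rintro rfl; exact hc ha) _
  sum_one := by simp

instance : Nonempty (Selector G p s) :=
  let ⟨a, ha⟩ := G.av_nonempty p s
  ⟨pure a ha⟩

theorem range_toFun : Set.range (toFun : Selector G p s → G.Act p → ℝ) =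
    stdSimplex ℝ (G.Act p) ∩ {f | ∀ a, a ∉ G.Av p s → f a = 0} := by
  ext f
  constructor
  · rintro ⟨ξ, rfl⟩
    exact ⟨⟨ξ.nonneg, ξ.sum_one⟩, ξ.support_av⟩
  · rintro ⟨⟨hnonneg, hsum⟩, hsupp⟩
    exact ⟨⟨f, hnonneg, hsupp, hsum⟩, rfl⟩

theorem isCompact_range_toFun :
    IsCompact (Set.range (toFun : Selector G p s → G.Act p → ℝ)) := by
  rw [range_toFun]
  refine (isCompact_stdSimplex ℝ (G.Act p)).inter_right ?_
  simp only [Set.ofPred_forall]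
  exact isClosed_iInter fun a => isClosed_iInter fun _ =>
    isClosed_eq (continuous_apply a) continuous_const

end Selector

namespace Game

variable (Gm : Game)

theorem exists_oppAvailable (s : Gm.State) : ∃ b : Gm.OppAct, Gm.OppAvailable s b :=
  ⟨fun p => (Gm.av_nonempty p.1 s).choose, fun p => (Gm.av_nonempty p.1 s).choose_spec⟩

variable {Gm}

/-- The opponent selector playing a fixed available joint action. -/
def OppSelector.pure {s : Gm.State} (b : Gm.OppAct) (hb : Gm.OppAvailable s b) :
    Gm.OppSelector s where
  toFun := Pi.single b 1
  nonneg c := by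
    by_cases h : c = b
    · subst h; simp
    · simp [h]
  support_av c hc := Pi.single_eq_of_ne (by rintro rfl; exact hc hb) _
  sum_one := by simp

theorem preSel_pure (v : Gm.State → ℝ) {s : Gm.State} (ξ : Gm.TeamSelector s) (b : Gm.OppAct)
    (hb : Gm.OppAvailable s b) :
    Gm.preSel v s ξ (OppSelector.pure b hb) = Gm.preTeamAct v s ξ b := by
  simp [preSel, OppSelector.pure, Pi.single_apply]

theorem bddBelow_range_preSel (v : Gm.State → ℝ) {s : Gm.State} (ξ : Gm.TeamSelector s) :
    BddBelow (Set.range (Gm.preSel v s ξ)) := by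
  refine ⟨∑ b, -|Gm.preTeamAct v s ξ b|, ?_⟩
  rintro _ ⟨ζ, rfl⟩
  refine Finset.sum_le_sum fun b _ => ?_
  have hle : ζ.toFun b ≤ 1 :=
    ζ.sum_one ▸ Finset.single_le_sum (fun c _ => ζ.nonneg c) (Finset.mem_univ b)
  calc -|Gm.preTeamAct v s ξ b| ≤ -(ζ.toFun b * |Gm.preTeamAct v s ξ b|) :=
        neg_le_neg (mul_le_of_le_one_left (abs_nonneg _) hle)
    _ = ζ.toFun b * -|Gm.preTeamAct v s ξ b| := by ring
    _ ≤ ζ.toFun b * Gm.preTeamAct v s ξ b :=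
        mul_le_mul_of_nonneg_left (neg_abs_le _) (ζ.nonneg b)

theorem iInf_preSel_le_preTeamAct (v : Gm.State → ℝ) {s : Gm.State} (ξ : Gm.TeamSelector s)
    (b : Gm.OppAct) (hb : Gm.OppAvailable s b) :
    ⨅ ζ, Gm.preSel v s ξ ζ ≤ Gm.preTeamAct v s ξ b :=
  (ciInf_le (bddBelow_range_preSel v ξ) (OppSelector.pure b hb)).trans_eq (preSel_pure v ξ b hb)

variable (Gm)

open Classical in
/-- The predecessor operator is attained: some collective selector guarantees the value `pre v s`
against every available joint opponent action. -/
theorem exists_teamSelector_pre_le_preTeamAct (v : Gm.State → ℝ) (s : Gm.State) :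
    ∃ ξ : Gm.TeamSelector s, ∀ b : Gm.OppAct, Gm.OppAvailable s b →
      Gm.pre v s ≤ Gm.preTeamAct v s ξ b := by
  let A : Finset Gm.OppAct := Finset.univ.filter (Gm.OppAvailable s)
  have hA : A.Nonempty := by
    obtain ⟨b, hb⟩ := Gm.exists_oppAvailable s
    exact ⟨b, by simpa [A] using hb⟩
  let K : Set ((p : Gm.TeamPlayer) → Gm.Act p.1 → ℝ) :=
    Set.univ.pi fun p => Set.range (Selector.toFun : Selector Gm.toGameStructure p.1 s → _)
  have hK : IsCompact K := isCompact_univ_pi fun p => Selector.isCompact_range_toFun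
  have hmem (ξ : Gm.TeamSelector s) : (fun p => (ξ p).toFun) ∈ K := fun p _ => ⟨ξ p, rfl⟩
  let F (x : (p : Gm.TeamPlayer) → Gm.Act p.1 → ℝ) (b : Gm.OppAct) : ℝ :=
    ∑ a : Gm.TeamAct, (∏ p, x p (a p)) * ∑ t, Gm.trans s (Gm.combineAct a b) t * v t
  have hF : Continuous fun x => A.inf' hA (F x) := by
    refine Continuous.finset_inf'_apply hA fun b _ => ?_
    fun_prop
  obtain ⟨x, hx, hmax⟩ :=
    hK.exists_isMaxOn ⟨_, hmem fun _ => Classical.arbitrary _⟩ hF.continuousOn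
  choose ξ hξ using fun p => hx p (Set.mem_univ p)
  refine ⟨ξ, fun b hb => ?_⟩
  have hFξ : F x b = Gm.preTeamAct v s ξ b := by simp only [F, preTeamAct, hξ]
  rw [← hFξ]
  refine ciSup_le fun η => ?_
  calc ⨅ ζ, Gm.preSel v s η ζ ≤ A.inf' hA (F fun p => (η p).toFun) :=
        Finset.le_inf' _ _ fun c hc =>
          iInf_preSel_le_preTeamAct v η c (Finset.mem_filter.mp hc).2
    _ ≤ A.inf' hA (F x) := hmax (hmem η)
    _ ≤ F x b := Finset.inf'_le _ (by simpa [A] using hb)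

end Game

/-- Fix `n` and let `ℓ s` be, for each non-target state `s`, the
smallest `k ∈ {1, …, n}` with `vIter k s = vIter n s`. Then at every non-target
state `s` there is a collective selector whose expected value of the valuation
`vIter (ℓ s - 1)` at the successor is at least `vIter (ℓ s) s`, against every
available opponent action. -/
theorem rank_selector_exists (Gm : Game) (n : ℕ) (hn : 1 ≤ n) (ℓ : Gm.State → ℕ)
    (hℓ : ∀ s ∉ Gm.target, 1 ≤ ℓ s ∧ ℓ s ≤ n ∧ Gm.vIter (ℓ s) s = Gm.vIter n s)
    (hℓmin : ∀ s ∉ Gm.target, ∀ k, 1 ≤ k → k ≤ n → Gm.vIter k s = Gm.vIter n s → ℓ s ≤ k) :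
    ∀ s ∉ Gm.target, ∃ ξ : Gm.TeamSelector s,
      ∀ b : Gm.OppAct, Gm.OppAvailable s b →
        Gm.vIter (ℓ s) s ≤ Gm.preTeamAct (Gm.vIter (ℓ s - 1)) s ξ b := by
  intro s hs
  obtain ⟨k, hk⟩ := Nat.exists_eq_add_of_le' (hℓ s hs).1
  rw [hk, Nat.add_sub_cancel]
  exact Gm.exists_teamSelector_pre_le_preTeamAct (Gm.vIter k) s
end
end

section
/- Let W be the set of states from which the team has a collective strategy guaranteeing that T is reached with probability 1 against every opponent strategy, let W_0 = T and W_{k+1} = W_k ∪ {s ∈ W : there exists a collective selector at s such that for every opponent action available at s, the successor lies in W_k with positive probability and in W with probability 1}, and for s ∈ W let its rank be the least k with s ∈ W_k. Let η be any memoryless collective strategy such that, at each state s ∈ W of rank k > 0, the team plays a collective selector for which, for every opponent action available at s, the successor lies in W_{k−1} with positive probability and in W with probability 1. Then for every state s ∈ W and every opponent strategy, the play from s under η reaches T with probability 1. -/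
/-!
Common framework: team concurrent stochastic reachability games.
-/

noncomputable section

/-- The strategy playing the prescribed available actions with probability 1. -/
def Strategy.ofAction {G : GameStructure} {p : G.Player} (f : List G.State → G.State → G.Act p)
    (hf : ∀ h s, f h s ∈ G.Av p s) : Strategy G p where
  toFun h s a := if a = f h s then 1 else 0
  nonneg h s a := by split_ifs <;> norm_num
  support_av h s a ha := if_neg fun heq : a = f h s => ha (heq ▸ hf h s)
  sum_one h s := by simp

/-- The strategy playing the available action `b` after history `h` at state `s`, and following
`σ` everywhere else. -/
def Strategy.update {G : GameStructure} {p : G.Player} (σ : Strategy G p) (h : List G.State)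
    (s : G.State) (b : G.Act p) (hb : b ∈ G.Av p s) : Strategy G p where
  toFun g u a := if g = h ∧ u = s then (if a = b then 1 else 0) else σ.toFun g u a
  nonneg g u a := by
    split_ifs
    · norm_num
    · norm_num
    · exact σ.nonneg g u a
  support_av g u a ha := by
    split_ifs with h1 h2
    · exact absurd (h2 ▸ h1.2 ▸ hb) ha
    · rfl
    · exact σ.support_av g u a ha
  sum_one g u := by
    split_ifs
    · simp
    · exact σ.sum_one g u

/-- The strategy applying `σ` to transformed histories. -/
def Strategy.comapHistory {G : GameStructure} {p : G.Player} (σ : Strategy G p)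
    (e : List G.State → List G.State) : Strategy G p where
  toFun h := σ.toFun (e h)
  nonneg h := σ.nonneg (e h)
  support_av h := σ.support_av (e h)
  sum_one h := σ.sum_one (e h)

/-- The selector played by a strategy after a given history. -/
def Strategy.selector {G : GameStructure} {p : G.Player} (σ : Strategy G p) (h : List G.State)
    (s : G.State) : Selector G p s where
  toFun := σ.toFun h s
  nonneg := σ.nonneg h s
  support_av := σ.support_av h s
  sum_one := σ.sum_one h s

namespace Game

variable {Gm : Game}

lemma stepProb_combine (σ : Gm.TeamStrategy) (τ : Gm.OppStrategy) (h : List Gm.State)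
    (s t : Gm.State) :
    Gm.stepProb (Gm.combine σ τ) h s t =
      ∑ b : Gm.OppAct, (∏ p, (τ p).toFun h s (b p)) * Gm.succProbTeam σ h s b t := by
  have hprod (a : Gm.TeamAct) (b : Gm.OppAct) :
      ∏ p, (Gm.combine σ τ p).toFun h s (Gm.combineAct a b p) =
        (∏ p, (σ p).toFun h s (a p)) * ∏ p, (τ p).toFun h s (b p) := by
    have hteam (p : Gm.TeamPlayer) : (σ p).toFun h s (a p) =
        (Gm.combine σ τ p).toFun h s (Gm.combineAct a b p) := by
      simp [combine, combineAct, p.2]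
    have hopp (p : Gm.OppPlayer) : (τ p).toFun h s (b p) =
        (Gm.combine σ τ p).toFun h s (Gm.combineAct a b p) := by
      simp [combine, combineAct, p.2]
    simp_rw [hteam, hopp]
    convert (Fintype.prod_subtype_mul_prod_subtype (fun p => p ∈ Gm.team) fun p =>
      (Gm.combine σ τ p).toFun h s (Gm.combineAct a b p)).symm
  unfold stepProb succProbTeam
  rw [← (Equiv.piEquivPiSubtypeProd (fun p => p ∈ Gm.team) Gm.Act).symm.sum_comp,
    Fintype.sum_prod_type_right]
  refine Finset.sum_congr rfl fun b _ => ?_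
  rw [Finset.mul_sum]
  refine Finset.sum_congr rfl fun a _ => ?_
  change (∏ p, (Gm.combine σ τ p).toFun h s (Gm.combineAct a b p)) *
    Gm.trans s (Gm.combineAct a b) t = _
  rw [hprod]
  ring

lemma stepProb_nonneg (π : (p : Gm.Player) → Strategy Gm.toGameStructure p)
    (h : List Gm.State) (s t : Gm.State) : 0 ≤ Gm.stepProb π h s t :=
  Finset.sum_nonneg fun a _ =>
    mul_nonneg (Finset.prod_nonneg fun p _ => (π p).nonneg h s _) (Gm.trans_nonneg s a t)

lemma stepProb_sum (π : (p : Gm.Player) → Strategy Gm.toGameStructure p)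
    (h : List Gm.State) (s : Gm.State) : ∑ t, Gm.stepProb π h s t = 1 := by
  unfold stepProb
  rw [Finset.sum_comm]
  simp_rw [← Finset.mul_sum, Gm.trans_sum, mul_one]
  rw [← Fintype.prod_sum fun p a => (π p).toFun h s a]
  simp [Strategy.sum_one]

lemma succProbTeam_nonneg (σ : Gm.TeamStrategy) (h : List Gm.State) (s : Gm.State)
    (b : Gm.OppAct) (t : Gm.State) : 0 ≤ Gm.succProbTeam σ h s b t :=
  Finset.sum_nonneg fun _ _ =>
    mul_nonneg (Finset.prod_nonneg fun p _ => (σ p).nonneg h s _) (Gm.trans_nonneg s _ t)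

lemma succProbTeam_sum (σ : Gm.TeamStrategy) (h : List Gm.State) (s : Gm.State)
    (b : Gm.OppAct) : ∑ t, Gm.succProbTeam σ h s b t = 1 := by
  unfold succProbTeam
  rw [Finset.sum_comm]
  simp_rw [← Finset.mul_sum, Gm.trans_sum, mul_one]
  rw [← Fintype.prod_sum fun p a => (σ p).toFun h s a]
  simp [Strategy.sum_one]

/-- Against opponents playing a fixed joint action, the successor is distributed as
`succProbTeam`. -/
lemma stepProb_combine_of_opp_pure (σ : Gm.TeamStrategy) (τ : Gm.OppStrategy)
    (h : List Gm.State) (s t : Gm.State) (b : Gm.OppAct)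
    (hτ : ∀ p a, (τ p).toFun h s a = if a = b p then 1 else 0) :
    Gm.stepProb (Gm.combine σ τ) h s t = Gm.succProbTeam σ h s b t := by
  rw [stepProb_combine, Finset.sum_eq_single b]
  · simp [hτ]
  · intro b' _ hb'
    obtain ⟨p, hp⟩ := Function.ne_iff.mp hb'
    rw [Finset.prod_eq_zero (Finset.mem_univ p) (by simp [hτ, hp]), zero_mul]
  · simp

/-- A lower bound on the mass of a set that holds against every available joint opponent action
holds against every opponent strategy. -/
lemma le_sum_indicator_stepProb (σ : Gm.TeamStrategy) (τ : Gm.OppStrategy)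
    (h : List Gm.State) (s : Gm.State) (A : Set Gm.State) (r : ℝ)
    (hr : ∀ b, Gm.OppAvailable s b → r ≤ ∑ t, A.indicator (Gm.succProbTeam σ h s b) t) :
    r ≤ ∑ t, A.indicator (Gm.stepProb (Gm.combine σ τ) h s) t := by
  have hw : ∑ b : Gm.OppAct, ∏ p, (τ p).toFun h s (b p) = 1 := by
    rw [← Fintype.prod_sum fun p a => (τ p).toFun h s a]
    simp [Strategy.sum_one]
  have hsum : ∑ t, A.indicator (Gm.stepProb (Gm.combine σ τ) h s) t =
      ∑ b : Gm.OppAct, (∏ p, (τ p).toFun h s (b p)) *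
        ∑ t, A.indicator (Gm.succProbTeam σ h s b) t := by
    simp_rw [Finset.mul_sum]
    rw [Finset.sum_comm]
    refine Finset.sum_congr rfl fun t _ => ?_
    by_cases ht : t ∈ A
    · simp [ht, stepProb_combine]
    · simp [ht]
  rw [hsum]
  calc r = ∑ b : Gm.OppAct, (∏ p, (τ p).toFun h s (b p)) * r := by
        rw [← Finset.sum_mul, hw, one_mul]
    _ ≤ _ := by
        refine Finset.sum_le_sum fun b _ => ?_
        by_cases hb : Gm.OppAvailable s b
        · exact mul_le_mul_of_nonneg_left (hr b hb)
            (Finset.prod_nonneg fun p _ => (τ p).nonneg h s _)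
        · obtain ⟨p, hp⟩ := not_forall.mp hb
          rw [Finset.prod_eq_zero (Finset.mem_univ p) ((τ p).support_av h s _ hp), zero_mul,
            zero_mul]

lemma reachWithin_of_mem_target (π : (p : Gm.Player) → Strategy Gm.toGameStructure p) (n : ℕ)
    (h : List Gm.State) {s : Gm.State} (hs : s ∈ Gm.target) : Gm.reachWithin π n h s = 1 := by
  cases n <;> simp [reachWithin, hs]

lemma reachWithin_succ (π : (p : Gm.Player) → Strategy Gm.toGameStructure p) (n : ℕ)
    (h : List Gm.State) {s : Gm.State} (hs : s ∉ Gm.target) :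
    Gm.reachWithin π (n + 1) h s =
      ∑ t, Gm.stepProb π h s t * Gm.reachWithin π n (h ++ [s]) t := by
  simp [reachWithin, hs]

lemma reachWithin_nonneg (π : (p : Gm.Player) → Strategy Gm.toGameStructure p) (n : ℕ)
    (h : List Gm.State) (s : Gm.State) : 0 ≤ Gm.reachWithin π n h s := by
  induction n generalizing h s with
  | zero => unfold reachWithin; split_ifs <;> norm_num
  | succ n ih =>
    unfold reachWithin
    split_ifs
    · norm_num
    · exact Finset.sum_nonneg fun t _ => mul_nonneg (stepProb_nonneg π h s t) (ih _ t)

lemma reachWithin_le_one (π : (p : Gm.Player) → Strategy Gm.toGameStructure p) (n : ℕ)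
    (h : List Gm.State) (s : Gm.State) : Gm.reachWithin π n h s ≤ 1 := by
  induction n generalizing h s with
  | zero => unfold reachWithin; split_ifs <;> norm_num
  | succ n ih =>
    unfold reachWithin
    split_ifs
    · norm_num
    · rw [← stepProb_sum π h s]
      exact Finset.sum_le_sum fun t _ =>
        mul_le_of_le_one_right (stepProb_nonneg π h s t) (ih _ t)

lemma reachWithin_mono (π : (p : Gm.Player) → Strategy Gm.toGameStructure p)
    (h : List Gm.State) (s : Gm.State) : Monotone fun n => Gm.reachWithin π n h s := by
  refine monotone_nat_of_le_succ fun n => ?_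
  induction n generalizing h s with
  | zero =>
    by_cases hs : s ∈ Gm.target
    · simp [reachWithin_of_mem_target, hs]
    · simpa [reachWithin, hs] using reachWithin_nonneg π 1 h s
  | succ n ih =>
    by_cases hs : s ∈ Gm.target
    · simp [reachWithin_of_mem_target, hs]
    · simp only [reachWithin_succ π _ h hs]
      exact Finset.sum_le_sum fun t _ =>
        mul_le_mul_of_nonneg_left (ih _ t) (stepProb_nonneg π h s t)

/-- The probability of reaching the target depends only on the behaviour of the profile on
histories extending the current one. -/
lemma reachWithin_congr {π π' : (p : Gm.Player) → Strategy Gm.toGameStructure p}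
    (n : ℕ) {h h' : List Gm.State} {s : Gm.State}
    (heq : ∀ g u p, (π p).toFun (h ++ g) u = (π' p).toFun (h' ++ g) u) :
    Gm.reachWithin π n h s = Gm.reachWithin π' n h' s := by
  induction n generalizing h h' s with
  | zero => rfl
  | succ n ih =>
    by_cases hs : s ∈ Gm.target
    · simp [reachWithin_of_mem_target, hs]
    · rw [reachWithin_succ π n h hs, reachWithin_succ π' n h' hs]
      refine Finset.sum_congr rfl fun t _ => ?_
      have hstep : Gm.stepProb π h s t = Gm.stepProb π' h' s t := by
        have h0 (p : Gm.Player) : (π p).toFun h s = (π' p).toFun h' s := by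
          simpa using heq [] s p
        simp [stepProb, h0]
      rw [hstep, ih (h := h ++ [s]) (h' := h' ++ [s])]
      intro g u p
      simpa using heq (s :: g) u p

/-- Probability of eventually reaching the target from state `s` after history `h`. -/
def reachProbAfter (π : (p : Gm.Player) → Strategy Gm.toGameStructure p)
    (h : List Gm.State) (s : Gm.State) : ℝ :=
  ⨆ n : ℕ, Gm.reachWithin π n h s

lemma bddAbove_reachWithin (π : (p : Gm.Player) → Strategy Gm.toGameStructure p)
    (h : List Gm.State) (s : Gm.State) :
    BddAbove (Set.range fun n => Gm.reachWithin π n h s) :=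
  ⟨1, by rintro _ ⟨n, rfl⟩; exact reachWithin_le_one π n h s⟩

lemma tendsto_reachWithin (π : (p : Gm.Player) → Strategy Gm.toGameStructure p)
    (h : List Gm.State) (s : Gm.State) :
    Filter.Tendsto (fun n => Gm.reachWithin π n h s) Filter.atTop
      (nhds (reachProbAfter π h s)) :=
  tendsto_atTop_ciSup (reachWithin_mono π h s) (bddAbove_reachWithin π h s)

lemma reachProbAfter_le_one (π : (p : Gm.Player) → Strategy Gm.toGameStructure p)
    (h : List Gm.State) (s : Gm.State) : reachProbAfter π h s ≤ 1 :=
  ciSup_le fun n => reachWithin_le_one π n h s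

lemma reachProbAfter_nonneg (π : (p : Gm.Player) → Strategy Gm.toGameStructure p)
    (h : List Gm.State) (s : Gm.State) : 0 ≤ reachProbAfter π h s :=
  Real.iSup_nonneg fun n => reachWithin_nonneg π n h s

lemma reachProbAfter_of_mem_target (π : (p : Gm.Player) → Strategy Gm.toGameStructure p)
    (h : List Gm.State) {s : Gm.State} (hs : s ∈ Gm.target) : reachProbAfter π h s = 1 := by
  simp [reachProbAfter, reachWithin_of_mem_target, hs]

lemma reachProbAfter_eq_sum (π : (p : Gm.Player) → Strategy Gm.toGameStructure p)
    (h : List Gm.State) {s : Gm.State} (hs : s ∉ Gm.target) :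
    reachProbAfter π h s = ∑ t, Gm.stepProb π h s t * reachProbAfter π (h ++ [s]) t := by
  refine tendsto_nhds_unique
    ((tendsto_reachWithin π h s).comp (Filter.tendsto_add_atTop_nat 1)) ?_
  have hlim := tendsto_finsetSum Finset.univ fun t _ =>
    (tendsto_reachWithin π (h ++ [s]) t).const_mul (Gm.stepProb π h s t)
  exact hlim.congr fun n => (reachWithin_succ π n h hs).symm

lemma reachProbAfter_congr {π π' : (p : Gm.Player) → Strategy Gm.toGameStructure p}
    {h h' : List Gm.State} {s : Gm.State}
    (heq : ∀ g u p, (π p).toFun (h ++ g) u = (π' p).toFun (h' ++ g) u) :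
    reachProbAfter π h s = reachProbAfter π' h' s :=
  iSup_congr fun n => reachWithin_congr n heq

/-- The collective strategy `σ` wins almost surely from state `s` after history `h`. -/
def WinsAfter (σ : Gm.TeamStrategy) (h : List Gm.State) (s : Gm.State) : Prop :=
  ∀ τ : Gm.OppStrategy, reachProbAfter (Gm.combine σ τ) h s = 1

lemma mem_winSet_of_winsAfter {σ : Gm.TeamStrategy} {h : List Gm.State} {s : Gm.State}
    (hw : WinsAfter σ h s) : s ∈ Gm.winSet := by
  refine ⟨fun p => (σ p).comapHistory (h ++ ·), fun τ => ?_⟩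
  rw [← hw fun p => (τ p).comapHistory (List.drop h.length)]
  refine reachProbAfter_congr fun g u p => ?_
  by_cases hp : p ∈ Gm.team <;> simp [combine, hp, Strategy.comapHistory]

/-- A winning strategy keeps winning from every possible successor. -/
lemma WinsAfter.step {σ : Gm.TeamStrategy} {h : List Gm.State} {s t : Gm.State}
    (hw : WinsAfter σ h s) (hs : s ∉ Gm.target) {b : Gm.OppAct} (hb : Gm.OppAvailable s b)
    (ht : 0 < Gm.succProbTeam σ h s b t) : WinsAfter σ (h ++ [s]) t := by
  intro τ
  let τ' : Gm.OppStrategy := fun p => (τ p).update h s (b p) (hb p)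
  have hstep (u : Gm.State) :
      Gm.stepProb (Gm.combine σ τ') h s u = Gm.succProbTeam σ h s b u :=
    stepProb_combine_of_opp_pure σ τ' h s u b fun p a => by simp [τ', Strategy.update]
  have hcont (u : Gm.State) : reachProbAfter (Gm.combine σ τ') (h ++ [s]) u =
      reachProbAfter (Gm.combine σ τ) (h ++ [s]) u := by
    refine reachProbAfter_congr fun g v p => ?_
    by_cases hp : p ∈ Gm.team <;> simp [combine, hp, τ', Strategy.update]
  have hone := hw τ'
  rw [reachProbAfter_eq_sum _ h hs, ← succProbTeam_sum σ h s b] at hone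
  simp only [hstep, hcont] at hone
  have hle (u : Gm.State) : Gm.succProbTeam σ h s b u *
      reachProbAfter (Gm.combine σ τ) (h ++ [s]) u ≤ Gm.succProbTeam σ h s b u :=
    mul_le_of_le_one_right (succProbTeam_nonneg σ h s b u) (reachProbAfter_le_one _ _ u)
  have := (Finset.sum_eq_sum_iff_of_le fun u _ => hle u).mp hone t (Finset.mem_univ t)
  exact (mul_eq_left₀ ht.ne').mp this

lemma wSeq_mono : Monotone Gm.wSeq :=
  monotone_nat_of_le_succ fun _ => Set.subset_union_left

lemma exists_iUnion_wSeq_subset : ∃ K, ∀ k, Gm.wSeq k ⊆ Gm.wSeq K := by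
  obtain ⟨K, hK⟩ := WellFoundedGT.monotone_chain_condition
    (⟨Gm.wSeq, wSeq_mono⟩ : ℕ →o Set Gm.State)
  refine ⟨K, fun k => ?_⟩
  rcases le_total K k with h | h
  · exact (hK k h).ge
  · exact wSeq_mono h

/-- Every state of the almost-sure winning set has a rank. -/
lemma exists_winSet_subset_wSeq : ∃ K, Gm.winSet ⊆ Gm.wSeq K := by
  obtain ⟨K, hK⟩ := exists_iUnion_wSeq_subset (Gm := Gm)
  refine ⟨K, fun s₀ hs₀ => ?_⟩
  by_contra hs₀K
  obtain ⟨σ, hσ⟩ := hs₀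
  have hT {s : Gm.State} (hs : s ∉ Gm.wSeq K) : s ∉ Gm.target := fun h => hs (hK 0 h)
  have hact (h : List Gm.State) (s : Gm.State) : ∃ b : Gm.OppAct, Gm.OppAvailable s b ∧
      (WinsAfter σ h s → s ∉ Gm.wSeq K → ∀ t ∈ Gm.wSeq K, Gm.succProbTeam σ h s b t = 0) := by
    by_cases hws : WinsAfter σ h s ∧ s ∉ Gm.wSeq K
    · obtain ⟨hw, hs⟩ := hws
      have hnot : ¬ ∀ b : Gm.OppAct, Gm.OppAvailable s b →
          (0 < ∑ t, (Gm.wSeq K).indicator (Gm.succProbTeam σ h s b) t) ∧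
          (∑ t, Gm.winSet.indicator (Gm.succProbTeam σ h s b) t = 1) := fun hall =>
        hs (hK (K + 1) (Or.inr ⟨mem_winSet_of_winsAfter hw,
          fun p => (σ p).selector h s, hall⟩))
      push Not at hnot
      obtain ⟨b, hb, hb'⟩ := hnot
      refine ⟨b, hb, fun _ _ t ht => ?_⟩
      by_contra hne
      have hpos : 0 < ∑ t, (Gm.wSeq K).indicator (Gm.succProbTeam σ h s b) t := by
        refine Finset.sum_pos' (fun u _ => Set.indicator_nonneg
          (fun v _ => succProbTeam_nonneg σ h s b v) u) ⟨t, Finset.mem_univ t, ?_⟩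
        rw [Set.indicator_of_mem ht]
        exact lt_of_le_of_ne (succProbTeam_nonneg σ h s b t) (Ne.symm hne)
      refine hb' hpos ?_
      rw [← succProbTeam_sum σ h s b]
      refine Finset.sum_congr rfl fun u _ => ?_
      by_cases hu : u ∈ Gm.winSet
      · rw [Set.indicator_of_mem hu]
      · rw [Set.indicator_of_notMem hu]
        by_contra h0
        exact hu (mem_winSet_of_winsAfter (hw.step (hT hs) hb
          (lt_of_le_of_ne (succProbTeam_nonneg σ h s b u) h0)))
    · exact ⟨fun p => (Gm.av_nonempty p.1 s).choose, fun p => (Gm.av_nonempty p.1 s).choose_spec,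
        fun h1 h2 => absurd ⟨h1, h2⟩ hws⟩
  choose b hb hzero using hact
  let τ : Gm.OppStrategy := fun p => Strategy.ofAction (fun h s => b h s p) fun h s => hb h s p
  have hnever (n : ℕ) : ∀ (h : List Gm.State) (s : Gm.State), WinsAfter σ h s →
      s ∉ Gm.wSeq K → Gm.reachWithin (Gm.combine σ τ) n h s = 0 := by
    induction n with
    | zero => intro h s _ hs; simp [reachWithin, hT hs]
    | succ n ih =>
      intro h s hw hs
      rw [reachWithin_succ _ n h (hT hs)]
      refine Finset.sum_eq_zero fun t _ => ?_
      rw [stepProb_combine_of_opp_pure σ τ h s t (b h s) fun p a => rfl]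
      by_cases h0 : Gm.succProbTeam σ h s (b h s) t = 0
      · rw [h0, zero_mul]
      · rw [ih _ t (hw.step (hT hs) (hb h s)
          (lt_of_le_of_ne (succProbTeam_nonneg σ h s _ t) (Ne.symm h0)))
          fun ht => h0 (hzero h s hw hs t ht), mul_zero]
  have hone := hσ τ
  simp [reachProbFrom, hnever _ [] s₀ hσ hs₀K] at hone

lemma succProbTeam_memoryless {η : Gm.TeamStrategy} (hmem : Gm.MemorylessTeam η)
    (h h' : List Gm.State) (s : Gm.State) (b : Gm.OppAct) :
    Gm.succProbTeam η h s b = Gm.succProbTeam η h' s b := by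
  funext t
  have hp (p : Gm.TeamPlayer) : (η p).toFun h s = (η p).toFun h' s := hmem p h h' s
  simp [succProbTeam, hp]

/-- If the successor stays in `W`, where the continuation is worth at least `c`, and lies with
probability at least `δ` in `A ⊆ W`, where it is worth at least `c + d`, then the current value
is at least `c + δ * d`. -/
lemma le_reachProbAfter_of_step (π : (p : Gm.Player) → Strategy Gm.toGameStructure p)
    {h : List Gm.State} {s : Gm.State} (hs : s ∉ Gm.target) {A W : Set Gm.State}
    {c d δ : ℝ} (hd : 0 ≤ d)
    (hA : ∀ t ∈ A, c + d ≤ reachProbAfter π (h ++ [s]) t)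
    (hW : ∀ t ∈ W, c ≤ reachProbAfter π (h ++ [s]) t)
    (hδ : δ ≤ ∑ t, A.indicator (Gm.stepProb π h s) t)
    (hstay : 1 ≤ ∑ t, W.indicator (Gm.stepProb π h s) t) :
    c + δ * d ≤ reachProbAfter π h s := by
  have hle (t : Gm.State) : W.indicator (Gm.stepProb π h s) t ≤ Gm.stepProb π h s t :=
    Set.indicator_le_self' (fun _ _ => stepProb_nonneg π h s _) t
  have hout (t : Gm.State) : W.indicator (Gm.stepProb π h s) t = Gm.stepProb π h s t :=
    (Finset.sum_eq_sum_iff_of_le fun t _ => hle t).mp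
      (le_antisymm (Finset.sum_le_sum fun t _ => hle t) ((stepProb_sum π h s).trans_le hstay))
      t (Finset.mem_univ t)
  rw [reachProbAfter_eq_sum π h hs]
  calc c + δ * d
      ≤ (∑ t, Gm.stepProb π h s t) * c + (∑ t, A.indicator (Gm.stepProb π h s) t) * d := by
        rw [stepProb_sum, one_mul]
        gcongr
    _ = ∑ t, (Gm.stepProb π h s t * c + A.indicator (Gm.stepProb π h s) t * d) := by
        rw [Finset.sum_add_distrib, Finset.sum_mul, Finset.sum_mul]
    _ ≤ _ := by
        refine Finset.sum_le_sum fun t _ => ?_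
        have h0 := stepProb_nonneg π h s t
        by_cases htA : t ∈ A
        · rw [Set.indicator_of_mem htA, ← mul_add]
          exact mul_le_mul_of_nonneg_left (hA t htA) h0
        · rw [Set.indicator_of_notMem htA, zero_mul, add_zero]
          by_cases htW : t ∈ W
          · exact mul_le_mul_of_nonneg_left (hW t htW) h0
          · rw [← hout t, Set.indicator_of_notMem htW, zero_mul, zero_mul]

end Game

lemma exists_pos_le_of_pos {ι : Type*} [Finite ι] (f : ι → ℝ) :
    ∃ δ > 0, ∀ i, 0 < f i → δ ≤ f i := by
  rcases isEmpty_or_nonempty {i // 0 < f i} with hE | hN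
  · exact ⟨1, one_pos, fun i hi => (hE.false ⟨i, hi⟩).elim⟩
  · obtain ⟨i₀, h₀⟩ := Finite.exists_min fun i : {i // 0 < f i} => f i
    exact ⟨f i₀, i₀.2, fun i hi => h₀ ⟨i, hi⟩⟩

/-- Any memoryless collective strategy that, at every state of the
almost-sure winning set of rank `k > 0`, moves to `wSeq (k-1)` with positive
probability and stays in the winning set with probability 1 against every
available opponent action, reaches the target with probability 1 from every
state of the winning set, against every opponent strategy. -/
theorem rank_reducing_memoryless_strategy_wins (Gm : Game) (η : Gm.TeamStrategy)
    (hmem : Gm.MemorylessTeam η)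
    (hη : ∀ s ∈ Gm.winSet, ∀ k : ℕ, s ∈ Gm.wSeq k → (∀ j < k, s ∉ Gm.wSeq j) → 0 < k →
      ∀ b : Gm.OppAct, Gm.OppAvailable s b →
        (0 < ∑ t, (Gm.wSeq (k - 1)).indicator (Gm.succProbTeam η [] s b) t) ∧
        (∑ t, Gm.winSet.indicator (Gm.succProbTeam η [] s b) t = 1)) :
    ∀ s ∈ Gm.winSet, ∀ τ : Gm.OppStrategy,
      Gm.reachProbFrom (Gm.combine η τ) s = 1 := by
  intro s₀ hs₀ τ
  set π := Gm.combine η τ with hπ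
  have : Nonempty (List Gm.State × Gm.winSet) := ⟨([], ⟨s₀, hs₀⟩)⟩
  set c : ℝ := ⨅ x : List Gm.State × Gm.winSet, Game.reachProbAfter π x.1 x.2.1 with hc
  have hc_le (h : List Gm.State) (s : Gm.State) (hs : s ∈ Gm.winSet) :
      c ≤ Game.reachProbAfter π h s :=
    ciInf_le (f := fun x : List Gm.State × Gm.winSet => Game.reachProbAfter π x.1 x.2.1)
      ⟨0, by rintro _ ⟨x, rfl⟩; exact Game.reachProbAfter_nonneg π x.1 x.2.1⟩ (h, ⟨s, hs⟩)
  have hc_one : c ≤ 1 := (hc_le [] s₀ hs₀).trans (Game.reachProbAfter_le_one π [] s₀)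
  have hgain (k : ℕ) : ∃ ε > 0, ∀ h, ∀ s ∈ Gm.wSeq k,
      c + ε * (1 - c) ≤ Game.reachProbAfter π h s := by
    induction k with
    | zero =>
      refine ⟨1, one_pos, fun h s hs => ?_⟩
      rw [Game.reachProbAfter_of_mem_target π h hs]
      linarith
    | succ k ih =>
      obtain ⟨ε, hε, hk⟩ := ih
      obtain ⟨δ, hδ, hmin⟩ := exists_pos_le_of_pos fun x : Gm.State × Gm.OppAct =>
        ∑ t, (Gm.wSeq k).indicator (Gm.succProbTeam η [] x.1 x.2) t
      refine ⟨min ε (δ * ε), lt_min hε (mul_pos hδ hε), fun h s hs => ?_⟩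
      have hc0 : 0 ≤ 1 - c := by linarith
      by_cases hsk : s ∈ Gm.wSeq k
      · refine le_trans ?_ (hk h s hsk)
        gcongr
        exact min_le_left _ _
      · have hsW : s ∈ Gm.winSet := (hs.resolve_left hsk).1
        have hrank := hη s hsW (k + 1) hs
          (fun j hj hsj => hsk (Game.wSeq_mono (Nat.lt_succ_iff.mp hj) hsj)) k.succ_pos
        calc c + min ε (δ * ε) * (1 - c) ≤ c + δ * (ε * (1 - c)) := by
              rw [← mul_assoc]
              gcongr
              exact min_le_right _ _
          _ ≤ Game.reachProbAfter π h s := by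
              refine Game.le_reachProbAfter_of_step π
                (fun hT => hsk (Game.wSeq_mono (Nat.zero_le k) hT))
                (mul_nonneg hε.le hc0) (fun t ht => hk _ t ht) (fun t ht => hc_le _ t ht) ?_ ?_
              · refine Game.le_sum_indicator_stepProb η τ h s _ _ fun b hb => ?_
                rw [Game.succProbTeam_memoryless hmem h []]
                exact hmin (s, b) (hrank b hb).1
              · refine Game.le_sum_indicator_stepProb η τ h s _ _ fun b hb => ?_
                rw [Game.succProbTeam_memoryless hmem h []]
                exact (hrank b hb).2.ge
  obtain ⟨K, hK⟩ := Game.exists_winSet_subset_wSeq (Gm := Gm)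
  obtain ⟨ε, hε, hbound⟩ := hgain K
  have himp : c + ε * (1 - c) ≤ c := le_ciInf fun x => hbound x.1 x.2.1 (hK x.2.2)
  have hc_ge : 1 ≤ c := by nlinarith
  exact le_antisymm (Game.reachProbAfter_le_one π [] s₀) (hc_ge.trans (hc_le [] s₀ hs₀))
end
end
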